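/- arXiv:2307.10122 — 6 statements merged into one kernel-verified Lean document; each statement's English description precedes it below -/
import Mathlib

section
/- Weighted Dirichlet theorem: For any real m×n matrix α = (α_{i,j}) and any real H > 1, there exists a pair (a, b) ∈ ℤ^m × ℤ^n with a ≠ 0 such that |aα − b|_τ < H^{-1} and |a|_η ≤ H, where aα ∈ ℝ^n denotes the vector with i-th coordinate Σ_{j=1}^m a_j α_{i,j}. -/
/-- The weighted quasi-norm `|x|_τ = max_i |x_i|^(1/τ_i)` on `ℝ^n`. -/
noncomputable def quasiNorm {n : ℕ} (τ : Fin n → ℝ) (x : Fin n → ℝ) : ℝ :=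
  ⨆ i, |x i| ^ (1 / τ i)

open MeasureTheory in
/-- Minkowski's linear forms theorem for integer points and a real matrix of determinant `±1`. -/
theorem exists_int_ne_zero_abs_mulVec_lt {ι : Type*} [Fintype ι] [DecidableEq ι]
    (A : Matrix ι ι ℝ) (hA : |A.det| = 1) (c : ι → ℝ) (hc : ∀ i, 0 < c i)
    (hprod : 1 < ∏ i, c i) :
    ∃ v : ι → ℤ, v ≠ 0 ∧ ∀ i, |A.mulVec (fun k => (v k : ℝ)) i| < c i := by
  set box : Set (ι → ℝ) := Set.univ.pi fun i => Set.Ioo (-c i) (c i) with hbox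
  have hmem (x : ι → ℝ) : x ∈ Matrix.toLin' A ⁻¹' box ↔ ∀ i, |A.mulVec x i| < c i := by
    simp [hbox, abs_lt, Matrix.toLin'_apply]
  have hdet : LinearMap.det (Matrix.toLin' A) ≠ 0 := by
    rw [LinearMap.det_toLin']
    intro h
    simp [h] at hA
  have hvol : volume (Matrix.toLin' A ⁻¹' box) = ENNReal.ofReal (∏ i, (2 * c i)) := by
    rw [Measure.addHaar_preimage_linearMap _ hdet, LinearMap.det_toLin', abs_inv, hA, hbox,
      Real.volume_pi_Ioo, ENNReal.ofReal_prod_of_nonneg fun i _ => by linarith [hc i]]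
    simp [two_mul]
  have hfund := ZSpan.isAddFundamentalDomain' (Pi.basisFun ℝ ι) volume
  have : Countable (Submodule.span ℤ (Set.range (Pi.basisFun ℝ ι))).toAddSubgroup :=
    inferInstanceAs (Countable (Submodule.span ℤ (Set.range (Pi.basisFun ℝ ι))))
  obtain ⟨x, hx0, hx⟩ := exists_ne_zero_mem_lattice_of_measure_mul_two_pow_lt_measure
    (L := (Submodule.span ℤ (Set.range (Pi.basisFun ℝ ι))).toAddSubgroup) hfund
    (s := Matrix.toLin' A ⁻¹' box)
    (fun x hx => by
      rw [hmem] at hx ⊢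
      simpa [Matrix.mulVec_neg] using hx)
    ((convex_pi fun i _ => convex_Ioo _ _).linear_preimage _)
    (by
      rw [hvol, ZSpan.volume_fundamentalDomain, Finset.prod_mul_distrib]
      have h1 : (Matrix.of (Pi.basisFun ℝ ι)).det = 1 := by
        rw [← Matrix.det_one (n := ι) (R := ℝ)]
        congr 1
        ext i j
        simp [Matrix.one_apply, Pi.single_apply, eq_comm]
      rw [h1, abs_one, ENNReal.ofReal_one, one_mul, Module.finrank_fintype_fun_eq_card,
        Finset.prod_const, Finset.card_univ, ← ENNReal.ofReal_ofNat, ← ENNReal.ofReal_pow (by simp)]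
      refine (ENNReal.ofReal_lt_ofReal_iff (by positivity)).2 ?_
      exact lt_mul_of_one_lt_right (by positivity) hprod)
  have hxm := ((Pi.basisFun ℝ ι).mem_span_iff_repr_mem ℤ (x : ι → ℝ)).1 x.2
  choose v hv using hxm
  have hxv : (x : ι → ℝ) = fun k => (v k : ℝ) := by
    ext k
    simpa using (hv k).symm
  refine ⟨v, ?_, ?_⟩
  · rintro rfl
    exact hx0 (Subtype.ext (hxv.trans (by ext; simp)))
  · rw [← hxv]
    exact (hmem _).1 hx

/-- A quasi-norm over a nonempty index set is attained at some coordinate. -/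
theorem exists_quasiNorm_eq {n : ℕ} (hn : 0 < n) (τ x : Fin n → ℝ) :
    ∃ i, quasiNorm τ x = |x i| ^ (1 / τ i) := by
  have : Nonempty (Fin n) := ⟨⟨0, hn⟩⟩
  obtain ⟨i, hi⟩ := exists_eq_ciSup_of_finite (f := fun i => |x i| ^ (1 / τ i))
  exact ⟨i, hi.symm⟩

/-- Weighted Dirichlet theorem. -/
theorem weighted_dirichlet (m n : ℕ) (hm : 0 < m) (hn : 0 < n)
    (τ : Fin n → ℝ) (η : Fin m → ℝ)
    (hτ : ∀ i, 0 < τ i) (hη : ∀ j, 0 < η j)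
    (hw : ∑ i, τ i = ∑ j, η j)
    (α : Matrix (Fin m) (Fin n) ℝ) (H : ℝ) (hH : 1 < H) :
    ∃ (a : Fin m → ℤ) (b : Fin n → ℤ), a ≠ 0 ∧
      quasiNorm τ (fun i => (∑ j, (a j : ℝ) * α j i) - (b i : ℝ)) < H⁻¹ ∧
      quasiNorm η (fun j => (a j : ℝ)) ≤ H := by
  have hH0 : 0 < H := by linarith
  set A : Matrix (Fin m ⊕ Fin n) (Fin m ⊕ Fin n) ℝ := Matrix.fromBlocks 1 0 α.transpose (-1)
    with hA
  set c : Fin m ⊕ Fin n → ℝ :=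
    Sum.elim (fun j => (⌊H ^ η j⌋ : ℝ) + 1) (fun i => H⁻¹ ^ τ i) with hc
  have hdet : |A.det| = 1 := by
    simp [hA, Matrix.det_fromBlocks_zero₁₂, Matrix.det_neg]
  have hprod : 1 < ∏ k, c k := by
    have : Nonempty (Fin m) := ⟨⟨0, hm⟩⟩
    have hlt : ∏ j, H ^ η j < ∏ j, ((⌊H ^ η j⌋ : ℝ) + 1) :=
      Finset.prod_lt_prod_of_nonempty (fun j _ => by positivity)
        (fun j _ => Int.lt_floor_add_one _) Finset.univ_nonempty
    have hone : (∏ j, H ^ η j) * ∏ i, H⁻¹ ^ τ i = 1 := by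
      rw [← Real.rpow_sum_of_pos hH0, ← Real.rpow_sum_of_pos (inv_pos.2 hH0), hw,
        Real.inv_rpow hH0.le, mul_inv_cancel₀ (by positivity)]
    rw [Fintype.prod_sum_type, ← hone]
    exact mul_lt_mul_of_pos_right hlt (Finset.prod_pos fun i _ => by positivity)
  have hcpos : ∀ k, 0 < c k := by
    rintro (j | i)
    · exact (by positivity : (0 : ℝ) < H ^ η j).trans (Int.lt_floor_add_one _)
    · simp only [hc, Sum.elim_inr]
      positivity
  obtain ⟨v, hv0, hv⟩ := exists_int_ne_zero_abs_mulVec_lt A hdet c hcpos hprod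
  have hva : ∀ j, |(v (.inl j) : ℝ)| < (⌊H ^ η j⌋ : ℝ) + 1 := fun j => by
    simpa [hA, hc, Matrix.fromBlocks_mulVec, Function.comp_def] using hv (.inl j)
  have hvb : ∀ i, |(∑ j, (v (.inl j) : ℝ) * α j i) - (v (.inr i) : ℝ)| < H⁻¹ ^ τ i := fun i => by
    have h := hv (.inr i)
    simp only [hA, hc, Matrix.fromBlocks_mulVec, Sum.elim_inr, Matrix.neg_mulVec,
      Matrix.one_mulVec] at h
    simpa [Matrix.mulVec, dotProduct, mul_comm, sub_eq_add_neg] using h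
  refine ⟨fun j => v (.inl j), fun i => v (.inr i), fun ha => hv0 ?_, ?_, ?_⟩
  · have ha' : ∀ j, v (.inl j) = 0 := congrFun ha
    ext (j | i)
    · exact ha' j
    · have h := (hvb i).trans (Real.rpow_lt_one (by positivity) (inv_lt_one_of_one_lt₀ hH) (hτ i))
      simp only [ha', Int.cast_zero, zero_mul, Finset.sum_const_zero, zero_sub, abs_neg] at h
      exact Int.abs_lt_one_iff.1 (by exact_mod_cast h)
  · obtain ⟨i, hi⟩ := exists_quasiNorm_eq hn τ
      (fun i => (∑ j, (v (.inl j) : ℝ) * α j i) - (v (.inr i) : ℝ))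
    rw [hi, one_div]
    exact (Real.rpow_inv_lt_iff_of_pos (abs_nonneg _) (by positivity) (hτ i)).2 (hvb i)
  · obtain ⟨j, hj⟩ := exists_quasiNorm_eq hm η (fun j => (v (.inl j) : ℝ))
    rw [hj, one_div]
    refine (Real.rpow_inv_le_iff_of_pos (abs_nonneg _) hH0.le (hη j)).2 ?_
    have h : |v (.inl j)| < ⌊H ^ η j⌋ + 1 := by exact_mod_cast hva j
    exact_mod_cast Int.le_floor.1 (Int.lt_add_one_iff.1 h)
end

section
/- Weighted Kim–Shapira theorem: Let α be a real m×n matrix that is (τ,η)-non-singular. Then for Lebesgue-almost every γ ∈ ℝ^n the following holds: for every ε > 0 there are infinitely many H ∈ ℕ such that there exists (a, b) ∈ ℤ^m × ℤ^n with |aα − b − γ|_τ < ε H^{-1} and |a|_η ≤ H. -/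
/-- `α` is `(τ,η)`-singular. -/
def IsSingular {m n : ℕ} (τ : Fin n → ℝ) (η : Fin m → ℝ)
    (α : Matrix (Fin m) (Fin n) ℝ) : Prop :=
  ∀ ε > (0 : ℝ), ∃ H₀ : ℝ, ∀ H > H₀, ∃ (a : Fin m → ℤ) (b : Fin n → ℤ), a ≠ 0 ∧
    quasiNorm τ (fun i => (∑ j, (a j : ℝ) * α j i) - (b i : ℝ)) < ε * H⁻¹ ∧
    quasiNorm η (fun j => (a j : ℝ)) ≤ H

open MeasureTheory Module

theorem exists_mem_span_norm_sub_lt {ι : Type*} [Fintype ι] (b : Basis ι ℝ (ι → ℝ)) (k : ℕ)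
    (hL : ∀ x ∈ Submodule.span ℤ (Set.range b), ‖x‖ < 1 → x = 0)
    (hk : volume (ZSpan.fundamentalDomain b) < k + 1) (p : ι → ℝ) :
    ∃ x ∈ Submodule.span ℤ (Set.range b), ‖p - x‖ < k + 1 := by
  set L : AddSubgroup (ι → ℝ) := (Submodule.span ℤ (Set.range b)).toAddSubgroup
  by_contra! hp
  let f : ℝ → ℝ := fun t => ‖((t • p : ι → ℝ) : (ι → ℝ) ⧸ L)‖
  have hf : Continuous f := by
    refine continuous_norm.comp (continuous_quotient_mk'.comp ?_)
    fun_prop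
  have hf0 : f 0 = 0 := by simp [f]
  have hf1 : (k + 1 : ℝ) ≤ f 1 := by
    simp only [f, one_smul]
    rw [QuotientAddGroup.norm_mk]
    refine (Metric.le_infDist ⟨0, L.zero_mem⟩).2 fun x hx => ?_
    rw [dist_eq_norm]
    exact hp x hx
  have hex : ∀ j ∈ Finset.range (k + 1), ∃ t, f t = j := by
    intro j hj
    have hj' : (j : ℝ) ≤ k + 1 := by
      have := (Finset.mem_range.1 hj).le
      exact_mod_cast this
    obtain ⟨t, -, ht⟩ := intermediate_value_Icc (zero_le_one (α := ℝ)) hf.continuousOn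
      (show (j : ℝ) ∈ Set.Icc (f 0) (f 1) from ⟨by rw [hf0]; positivity, hj'.trans hf1⟩)
    exact ⟨t, ht⟩
  choose! t ht using hex
  have hclose : ∀ i ∈ Finset.range (k + 1), ∀ j ∈ Finset.range (k + 1), ∀ x ∈ L,
      ‖t i • p - t j • p + x‖ < 1 → i = j := by
    intro i hi j hj x hx h
    have h1 : ‖((t i • p - t j • p + x : ι → ℝ) : (ι → ℝ) ⧸ L)‖ < 1 :=
      (QuotientAddGroup.norm_mk_le_norm).trans_lt h
    rw [QuotientAddGroup.mk_add, (QuotientAddGroup.eq_zero_iff x).2 hx, add_zero,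
      QuotientAddGroup.mk_sub] at h1
    have h2 := (abs_norm_sub_norm_le _ _).trans_lt h1
    change |f (t i) - f (t j)| < 1 at h2
    rw [ht i hi, ht j hj] at h2
    have : |(i : ℤ) - j| < 1 := by exact_mod_cast h2
    rw [Int.abs_lt_one_iff] at this
    omega
  let s : Set (ι → ℝ) := ⋃ j ∈ Finset.range (k + 1), Metric.ball (t j • p) (1 / 2)
  have hs : volume s = k + 1 := by
    rw [measure_biUnion_finset]
    · simp [Real.volume_pi_ball]
    · intro i hi j hj hij
      refine Set.disjoint_left.2 fun z hzi hzj => hij (hclose i hi j hj 0 L.zero_mem ?_)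
      rw [add_zero, ← dist_eq_norm]
      have := dist_triangle_left (t i • p) (t j • p) z
      rw [Metric.mem_ball] at hzi hzj
      linarith
    · intro j _
      exact measurableSet_ball
  have hsm : MeasurableSet s := Finset.measurableSet_biUnion _ fun _ _ => measurableSet_ball
  have : Countable L := inferInstanceAs (Countable (Submodule.span ℤ (Set.range b)))
  obtain ⟨x, y, hxy, hd⟩ := exists_pair_mem_lattice_not_disjoint_vadd
    (ZSpan.isAddFundamentalDomain' b volume) hsm.nullMeasurableSet (hs ▸ hk)
  obtain ⟨_, ⟨u, hu, rfl⟩, v, hv, huv⟩ := Set.not_disjoint_iff.mp hd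
  obtain ⟨i, hi, hui⟩ := Set.mem_iUnion₂.1 hu
  obtain ⟨j, hj, hvj⟩ := Set.mem_iUnion₂.1 hv
  have huv' : (y : ι → ℝ) + v = x + u := huv
  have hnorm : ‖t i • p - t j • p + ((x - y : L) : ι → ℝ)‖ < 1 := by
    have : t i • p - t j • p + ((x - y : L) : ι → ℝ) = (v - t j • p) - (u - t i • p) := by
      push_cast
      have : v = x + u - y := by rw [← huv']; abel
      rw [this]; abel
    rw [this]
    rw [mem_ball_iff_norm] at hui hvj
    have := norm_sub_le (v - t j • p) (u - t i • p)
    linarith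
  obtain rfl := hclose i hi j hj _ (x - y).2 hnorm
  rw [sub_self, zero_add] at hnorm
  exact hxy (sub_eq_zero.1 (Subtype.ext (hL _ (x - y).2 hnorm)))

theorem exists_int_abs_sub_lt {ι : Type*} [Fintype ι] (φ : (ι → ℝ) ≃ₗ[ℝ] (ι → ℝ))
    (r : ι → ℝ) (hr : ∀ i, 0 < r i) (k : ℕ)
    (hφ : ∀ z : ι → ℤ, (∀ i, |φ (fun i => (z i : ℝ)) i| < r i) → z = 0)
    (hk : |LinearMap.det (φ : (ι → ℝ) →ₗ[ℝ] (ι → ℝ))| < (k + 1) * ∏ i, r i) (p : ι → ℝ) :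
    ∃ z : ι → ℤ, ∀ i, |p i - φ (fun i => (z i : ℝ)) i| < (k + 1) * r i := by
  classical
  let D : (ι → ℝ) ≃ₗ[ℝ] (ι → ℝ) := LinearEquiv.piCongrRight fun i =>
    LinearEquiv.smulOfNeZero ℝ ℝ (r i)⁻¹ (inv_ne_zero (hr i).ne')
  have hD : ∀ x i, D x i = (r i)⁻¹ * x i := fun x i => rfl
  have hr' : 0 < ∏ i, r i := Finset.prod_pos fun i _ => hr i
  have hDdet : LinearMap.det (D : (ι → ℝ) →ₗ[ℝ] (ι → ℝ)) = (∏ i, r i)⁻¹ := by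
    have : (D : (ι → ℝ) →ₗ[ℝ] (ι → ℝ)) = Matrix.toLin' (Matrix.diagonal fun i => (r i)⁻¹) := by
      refine LinearMap.ext fun x => funext fun i => ?_
      simp [hD, Matrix.mulVec_diagonal]
    rw [this, LinearMap.det_toLin', Matrix.det_diagonal, Finset.prod_inv_distrib]
  let g := φ.trans D
  let b := (Pi.basisFun ℝ ι).map g
  have hspan : ∀ x, x ∈ Submodule.span ℤ (Set.range b) ↔
      ∃ z : ι → ℤ, g (fun i => (z i : ℝ)) = x := by
    intro x
    rw [← ZSpan.map]
    constructor
    · rintro ⟨w, hw, rfl⟩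
      have hw' := (Module.Basis.mem_span_iff_repr_mem ℤ (Pi.basisFun ℝ ι) w).1 hw
      choose z hz using hw'
      refine ⟨z, ?_⟩
      change g _ = g w
      congr 1
      funext i
      simpa using hz i
    · rintro ⟨z, rfl⟩
      exact ⟨_, (Module.Basis.mem_span_iff_repr_mem ℤ (Pi.basisFun ℝ ι) _).2
        fun i => ⟨z i, by simp⟩, rfl⟩
  have hvol : volume (ZSpan.fundamentalDomain b) < k + 1 := by
    rw [← ZSpan.map_fundamentalDomain, ← LinearEquiv.coe_coe, Measure.addHaar_image_linearMap,
      ZSpan.fundamentalDomain_pi_basisFun, Real.volume_pi_Ico]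
    have : (g : (ι → ℝ) →ₗ[ℝ] (ι → ℝ)) = (D : (ι → ℝ) →ₗ[ℝ] (ι → ℝ)) ∘ₗ φ := rfl
    rw [this, LinearMap.det_comp, hDdet, abs_mul, abs_of_pos (inv_pos.2 hr')]
    have h2 : (∏ i, r i)⁻¹ * |LinearMap.det (φ : (ι → ℝ) →ₗ[ℝ] (ι → ℝ))| < (k + 1 : ℕ) := by
      rw [inv_mul_lt_iff₀ hr', mul_comm]
      exact_mod_cast hk
    simpa using (ENNReal.ofReal_lt_natCast (Nat.succ_ne_zero k)).2 h2
  obtain ⟨x, hx, hpx⟩ := exists_mem_span_norm_sub_lt b k (fun x hx hx1 => by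
    obtain ⟨z, rfl⟩ := (hspan x).1 hx
    have : z = 0 := hφ z fun i => by
      have h := (pi_norm_lt_iff one_pos).1 hx1 i
      rwa [show g (fun i => (z i : ℝ)) i = (r i)⁻¹ * φ (fun i => (z i : ℝ)) i from rfl,
        Real.norm_eq_abs, abs_mul, abs_of_pos (inv_pos.2 (hr i)), inv_mul_lt_iff₀ (hr i),
        mul_one] at h
    subst this
    simp only [Pi.zero_apply, Int.cast_zero]
    exact map_zero g) hvol (D p)
  obtain ⟨z, rfl⟩ := (hspan x).1 hx
  refine ⟨z, fun i => ?_⟩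
  have h := (pi_norm_lt_iff (by positivity)).1 hpx i
  rwa [Pi.sub_apply, show g (fun i => (z i : ℝ)) i = (r i)⁻¹ * φ (fun i => (z i : ℝ)) i from rfl,
    hD, ← mul_sub, Real.norm_eq_abs, abs_mul, abs_of_pos (inv_pos.2 (hr i)),
    inv_mul_lt_iff₀ (hr i), mul_comm] at h

open Filter Metric Topology in
theorem ae_frequently_exists_dist_lt {X : Type*} [PseudoMetricSpace X] [SecondCountableTopology X]
    [MeasurableSpace X] [BorelSpace X] (μ : Measure X) [IsLocallyFiniteMeasure μ]
    [IsUnifLocDoublingMeasure μ] {s : ℕ → Set X} {r : ℕ → ℝ} (hr0 : ∀ l, 0 < r l)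
    (hr : Tendsto r atTop (𝓝 0)) {M : ℝ} (hM : 0 < M)
    (hs : ∀ l x, ∃ y ∈ s l, dist x y ≤ M * r l) {ε : ℝ} (hε : 0 < ε) :
    ∀ᵐ x ∂μ, ∃ᶠ l in atTop, ∃ y ∈ s l, dist x y < ε * r l := by
  have h1 := blimsup_cthickening_mul_ae_eq μ (fun _ => True) s (half_pos hε) r hr
  have h2 := blimsup_cthickening_mul_ae_eq μ (fun _ => True) s hM r hr
  filter_upwards [(h1.trans h2.symm).mem_iff] with x hx
  have hx1 : x ∈ blimsup (fun l => cthickening (ε / 2 * r l) (s l)) atTop (fun _ => True) := by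
    refine hx.2 ?_
    rw [blimsup_true, mem_limsup_iff_frequently_mem]
    refine Frequently.of_forall fun l => ?_
    obtain ⟨y, hy, hxy⟩ := hs l x
    exact mem_cthickening_of_dist_le x y _ _ hy hxy
  rw [blimsup_true, mem_limsup_iff_frequently_mem] at hx1
  refine hx1.mono fun l hl => ?_
  have hl' : x ∈ thickening (ε * r l) (s l) :=
    cthickening_subset_thickening' (mul_pos hε (hr0 l))
      (mul_lt_mul_of_pos_right (half_lt_self hε) (hr0 l)) _ hl
  exact mem_thickening_iff.1 hl'

open Filter Metric Topology in
theorem ae_frequently_exists_rpow_lt {ι : Type*} [Fintype ι] {p : ι → ℝ} (hp0 : ∀ i, 0 < p i)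
    (hp1 : ∀ i, p i ≤ 1) {s : ℕ → Set (ι → ℝ)} {r : ℕ → ℝ} (hr0 : ∀ l, 0 < r l)
    (hr : Tendsto r atTop (𝓝 0)) {M : ℝ} (hM : 0 < M)
    (hs : ∀ l, ∀ x : ι → ℝ, ∃ y ∈ s l, ∀ i, |y i - x i| ^ p i ≤ M * r l) {ε : ℝ} (hε : 0 < ε) :
    ∀ᵐ x : ι → ℝ, ∃ᶠ l in atTop, ∃ y ∈ s l, ∀ i, |y i - x i| ^ p i < ε * r l := by
  let X := ∀ i, Snowflaking ℝ (p i) (hp0 i) (hp1 i)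
  let : MeasurableSpace X := borel X
  have : BorelSpace X := ⟨rfl⟩
  let e : (ι → ℝ) ≃ₜ X := Homeomorph.piCongrRight fun i => Snowflaking.homeomorph.symm
  have he : ∀ x i, e x i = Snowflaking.toSnowflaking (x i) := fun x i => rfl
  have hdist : ∀ x y i, dist (e x i) (e y i) = |y i - x i| ^ p i := fun x y i => by
    rw [he, he, Snowflaking.dist_toSnowflaking_toSnowflaking, dist_comm, Real.dist_eq]
  let μ : Measure X := volume.map e
  have hball : ∀ x : X, ∀ δ, 0 ≤ δ →
      μ (closedBall x δ) = ∏ i, ENNReal.ofReal (2 * δ ^ (p i)⁻¹) := by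
    intro x δ hδ
    obtain ⟨x, rfl⟩ := e.surjective x
    rw [Measure.map_apply e.continuous.measurable measurableSet_closedBall]
    have : e ⁻¹' closedBall (e x) δ = Set.univ.pi fun i => closedBall (x i) (δ ^ (p i)⁻¹) := by
      ext y
      rw [Set.mem_preimage, mem_closedBall, dist_pi_le_iff hδ, Set.mem_univ_pi]
      refine forall_congr' fun i => ?_
      rw [hdist, mem_closedBall, dist_comm, Real.dist_eq,
        Real.le_rpow_inv_iff_of_pos (abs_nonneg _) hδ (hp0 i)]
    rw [this, volume_pi_pi]
    simp
  have : IsLocallyFiniteMeasure μ := ⟨fun x => ⟨closedBall x 1,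
    closedBall_mem_nhds x one_pos, by
      rw [hball x 1 zero_le_one]
      exact ENNReal.prod_lt_top fun i _ => ENNReal.ofReal_lt_top⟩⟩
  have : IsUnifLocDoublingMeasure μ := by
    refine ⟨∏ i, ((2 : ℝ) ^ (p i)⁻¹).toNNReal, ?_⟩
    filter_upwards [self_mem_nhdsWithin] with δ hδ x
    have hδ : 0 < δ := hδ
    rw [hball x _ (by positivity), hball x _ hδ.le, ENNReal.ofNNReal_finsetProd,
      ← Finset.prod_mul_distrib]
    refine Finset.prod_le_prod' fun i _ => ?_
    change _ ≤ ENNReal.ofReal _ * _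
    rw [← ENNReal.ofReal_mul (by positivity), Real.mul_rpow zero_le_two hδ.le, mul_left_comm]
  have h := ae_frequently_exists_dist_lt μ (s := fun l => e '' s l) hr0 hr hM (fun l x => by
    obtain ⟨x, rfl⟩ := e.surjective x
    obtain ⟨y, hy, hxy⟩ := hs l x
    refine ⟨e y, ⟨y, hy, rfl⟩, (dist_pi_le_iff (mul_pos hM (hr0 l)).le).2 fun i => ?_⟩
    rw [hdist]
    exact hxy i) hε
  filter_upwards [ae_of_ae_map e.continuous.aemeasurable h] with x hx
  refine hx.mono ?_
  rintro l ⟨_, ⟨y, hy, rfl⟩, hxy⟩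
  refine ⟨y, hy, fun i => ?_⟩
  rw [← hdist]
  exact (dist_pi_lt_iff (mul_pos hε (hr0 l))).1 hxy i

theorem quasiNorm_lt_iff {n : ℕ} {τ : Fin n → ℝ} (hτ : ∀ i, 0 < τ i) (x : Fin n → ℝ) {t : ℝ}
    (ht : 0 < t) : quasiNorm τ x < t ↔ ∀ i, |x i| < t ^ τ i := by
  have h : ∀ i, |x i| ^ (1 / τ i) < t ↔ |x i| < t ^ τ i := fun i => by
    rw [one_div, Real.rpow_inv_lt_iff_of_pos (abs_nonneg _) ht.le (hτ i)]
  simp_rw [← h, quasiNorm]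
  refine ⟨fun hx i => (le_ciSup (Set.finite_range _).bddAbove i).trans_lt hx, fun hx => ?_⟩
  rcases isEmpty_or_nonempty (Fin n) with h0 | h0
  · rwa [Real.iSup_of_isEmpty]
  · obtain ⟨i, hi⟩ := exists_eq_ciSup_of_finite (f := fun i => |x i| ^ (1 / τ i))
    rw [← hi]
    exact hx i

theorem quasiNorm_le_iff {n : ℕ} {τ : Fin n → ℝ} (hτ : ∀ i, 0 < τ i) (x : Fin n → ℝ) {t : ℝ}
    (ht : 0 ≤ t) : quasiNorm τ x ≤ t ↔ ∀ i, |x i| ≤ t ^ τ i := by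
  have h : ∀ i, |x i| ^ (1 / τ i) ≤ t ↔ |x i| ≤ t ^ τ i := fun i => by
    rw [one_div, Real.rpow_inv_le_iff_of_pos (abs_nonneg _) ht (hτ i)]
  simp_rw [← h, quasiNorm]
  exact ⟨fun hx i => (le_ciSup (Set.finite_range _).bddAbove i).trans hx,
    fun hx => Real.iSup_le hx ht⟩

theorem Int.eq_zero_of_abs_cast_lt_one {b : ℤ} (h : |(b : ℝ)| < 1) : b = 0 :=
  Int.abs_lt_one_iff.1 (by exact_mod_cast h)

/-- The involution `(v, u) ↦ (uα - v, u)` of `ℝ^n × ℝ^m`, whose values at integer vectors form the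
lattice attached to the matrix `α`. -/
noncomputable def latticeEquiv {m n : ℕ} (α : Matrix (Fin m) (Fin n) ℝ) :
    (Fin n ⊕ Fin m → ℝ) ≃ₗ[ℝ] (Fin n ⊕ Fin m → ℝ) :=
  LinearEquiv.ofInvolutive
    { toFun := fun z => Sum.elim (fun i => (∑ j, z (.inr j) * α j i) - z (.inl i))
        fun j => z (.inr j)
      map_add' := fun x y => by
        ext (i | j) <;> simp [add_mul, Finset.sum_add_distrib]
        ring
      map_smul' := fun c x => by
        ext (i | j) <;> simp [mul_assoc, Finset.mul_sum, mul_sub] }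
    fun z => by ext (i | j) <;> simp

theorem latticeEquiv_inl {m n : ℕ} (α : Matrix (Fin m) (Fin n) ℝ) (z : Fin n ⊕ Fin m → ℝ)
    (i : Fin n) : latticeEquiv α z (.inl i) = (∑ j, z (.inr j) * α j i) - z (.inl i) := rfl

theorem latticeEquiv_inr {m n : ℕ} (α : Matrix (Fin m) (Fin n) ℝ) (z : Fin n ⊕ Fin m → ℝ)
    (j : Fin m) : latticeEquiv α z (.inr j) = z (.inr j) := rfl

theorem exists_inhomogeneous_approx {m n : ℕ} {τ : Fin n → ℝ} {η : Fin m → ℝ}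
    (hτ : ∀ i, 0 < τ i) (hη : ∀ j, 0 < η j) (hw : ∑ i, τ i = ∑ j, η j)
    (α : Matrix (Fin m) (Fin n) ℝ) {c H : ℝ} (hc : 0 < c) (hcH : c ≤ H) (k : ℕ)
    (hk : |LinearMap.det (latticeEquiv α : (Fin n ⊕ Fin m → ℝ) →ₗ[ℝ] (Fin n ⊕ Fin m → ℝ))| <
      (k + 1) * c ^ ∑ i, τ i)
    (hH : ∀ (a : Fin m → ℤ) (b : Fin n → ℤ), a ≠ 0 →
      quasiNorm τ (fun i => (∑ j, (a j : ℝ) * α j i) - (b i : ℝ)) < c * H⁻¹ →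
      ¬ quasiNorm η (fun j => (a j : ℝ)) ≤ H) (γ : Fin n → ℝ) :
    ∃ (a : Fin m → ℤ) (b : Fin n → ℤ),
      (∀ i, |(∑ j, (a j : ℝ) * α j i) - b i - γ i| < (k + 1) * (c * H⁻¹) ^ τ i) ∧
      ∀ j, |(a j : ℝ)| < (k + 1) * H ^ η j := by
  have hH0 : 0 < H := hc.trans_le hcH
  have hcH0 : 0 < c * H⁻¹ := by positivity
  let r : Fin n ⊕ Fin m → ℝ := Sum.elim (fun i => (c * H⁻¹) ^ τ i) fun j => H ^ η j
  have hprod : ∏ i, r i = c ^ ∑ i, τ i := by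
    rw [Fintype.prod_sum_type]
    simp only [r, Sum.elim_inl, Sum.elim_inr]
    rw [← Real.rpow_sum_of_pos hcH0, ← Real.rpow_sum_of_pos hH0, ← hw,
      ← Real.mul_rpow hcH0.le hH0.le, inv_mul_cancel_right₀ hH0.ne']
  obtain ⟨z, hz⟩ := exists_int_abs_sub_lt (latticeEquiv α) r
    (by rintro (i | j) <;> simp only [r, Sum.elim_inl, Sum.elim_inr] <;> positivity) k
    (fun z hz => by
      have hz1 := fun i => hz (.inl i)
      have hz2 := fun j => hz (.inr j)
      simp only [latticeEquiv_inl, latticeEquiv_inr, r, Sum.elim_inl, Sum.elim_inr] at hz1 hz2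
      have ha : (fun j => z (.inr j)) = 0 := by
        by_contra ha
        exact hH _ (fun i => z (.inl i)) ha ((quasiNorm_lt_iff hτ _ hcH0).2 hz1)
          ((quasiNorm_le_iff hη _ hH0.le).2 fun j => (hz2 j).le)
      have ha' : ∀ j, z (.inr j) = 0 := fun j => congrFun ha j
      ext (i | j)
      · refine Int.eq_zero_of_abs_cast_lt_one ?_
        have h := hz1 i
        simp only [ha', Int.cast_zero, zero_mul, Finset.sum_const_zero, zero_sub, abs_neg] at h
        refine h.trans_le (Real.rpow_le_one hcH0.le ?_ (hτ i).le)
        rw [← div_eq_mul_inv]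
        exact div_le_one_of_le₀ hcH hH0.le
      · exact ha' j)
    (by rwa [hprod]) (Sum.elim γ fun _ => 0)
  refine ⟨fun j => z (.inr j), fun i => z (.inl i), fun i => ?_, fun j => ?_⟩
  · rw [abs_sub_comm]
    exact hz (.inl i)
  · have h := hz (.inr j)
    rwa [Sum.elim_inr, zero_sub, abs_neg] at h

/-- The weighted Kim–Shapira theorem. -/
theorem weighted_kim_shapira (m n : ℕ) (hm : 0 < m) (hn : 0 < n)
    (τ : Fin n → ℝ) (η : Fin m → ℝ)
    (hτ : ∀ i, 0 < τ i) (hη : ∀ j, 0 < η j)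
    (hw : ∑ i, τ i = ∑ j, η j)
    (α : Matrix (Fin m) (Fin n) ℝ) (hα : ¬ IsSingular τ η α) :
    ∀ᵐ γ ∂(MeasureTheory.volume : MeasureTheory.Measure (Fin n → ℝ)),
      ∀ ε > (0 : ℝ),
        {H : ℕ | ∃ (a : Fin m → ℤ) (b : Fin n → ℤ),
          quasiNorm τ (fun i => (∑ j, (a j : ℝ) * α j i) - (b i : ℝ) - γ i) < ε * (H : ℝ)⁻¹ ∧
          quasiNorm η (fun j => (a j : ℝ)) ≤ H}.Infinite := by
  have hn0 : Nonempty (Fin n) := ⟨⟨0, hn⟩⟩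
  simp only [IsSingular, not_forall, not_exists, not_and] at hα
  obtain ⟨c, hc, hα⟩ := hα
  obtain ⟨k, hk⟩ := exists_nat_gt
    (|LinearMap.det (latticeEquiv α : (Fin n ⊕ Fin m → ℝ) →ₗ[ℝ] (Fin n ⊕ Fin m → ℝ))| /
      c ^ ∑ i, τ i)
  rw [div_lt_iff₀ (by positivity)] at hk
  replace hk := hk.trans (mul_lt_mul_of_pos_right (lt_add_one (k : ℝ))
    (show 0 < c ^ ∑ i, τ i by positivity))
  choose H hHgt hH using fun l : ℕ => hα (max l (max c 1))
  have hHl : ∀ l : ℕ, (l : ℝ) < H l := fun l => (le_max_left _ _).trans_lt (hHgt l)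
  have hHc : ∀ l, c ≤ H l := fun l =>
    ((le_max_left _ _).trans (le_max_right _ _)).trans (hHgt l).le
  have hH1 : ∀ l, 1 ≤ H l := fun l =>
    ((le_max_right _ _).trans (le_max_right _ _)).trans (hHgt l).le
  have hH0 : ∀ l, 0 < H l := fun l => one_pos.trans_le (hH1 l)
  have hk1 : (1 : ℝ) ≤ k + 1 := by simp
  have hk0 : (0 : ℝ) < k + 1 := by positivity
  let σ : ℝ := (∑ i, 1 / τ i)⁻¹
  have hT : 0 < ∑ i, 1 / τ i :=
    Finset.sum_pos (fun i _ => one_div_pos.2 (hτ i)) Finset.univ_nonempty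
  have hσ : 0 < σ := inv_pos.2 hT
  have hp0 : ∀ i, 0 < σ / τ i := fun i => div_pos hσ (hτ i)
  have hp1 : ∀ i, σ / τ i ≤ 1 := fun i => by
    rw [div_eq_mul_one_div, inv_mul_le_iff₀ hT, mul_one]
    exact Finset.single_le_sum (fun i _ => (one_div_pos.2 (hτ i)).le) (Finset.mem_univ i)
  have hτσ : ∀ i, τ i * (σ / τ i) = σ := fun i => mul_div_cancel₀ σ (hτ i).ne'
  let C : ℝ := (k + 1) ^ ∑ j, 1 / η j
  have hC1 : 1 ≤ C := Real.one_le_rpow hk1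
    (Finset.sum_nonneg fun j _ => (one_div_pos.2 (hη j)).le)
  have hC0 : 0 < C := one_pos.trans_le hC1
  have hCη : ∀ j, (k + 1 : ℝ) ≤ C ^ η j := fun j => by
    rw [← Real.rpow_mul hk0.le]
    refine Real.self_le_rpow_of_one_le hk1 ?_
    rw [← div_le_iff₀ (hη j)]
    exact Finset.single_le_sum (f := fun j => 1 / η j) (fun j _ => (one_div_pos.2 (hη j)).le)
      (Finset.mem_univ j)
  let N : ℕ → ℕ := fun l => ⌈C * H l⌉₊
  have hN1 : ∀ l, C * H l ≤ N l := fun l => Nat.le_ceil _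
  have hHN : ∀ l, H l ≤ N l := fun l => (le_mul_of_one_le_left (hH0 l).le hC1).trans (hN1 l)
  have hN0 : ∀ l, (0 : ℝ) < N l := fun l => (hH0 l).trans_le (hHN l)
  have hN2 : ∀ l, (N l : ℝ) ≤ (C + 1) * H l := fun l => by
    have h := (Nat.ceil_lt_add_one (mul_pos hC0 (hH0 l)).le).le
    linarith [hH1 l]
  have hNl : ∀ l, l < N l := fun l => by exact_mod_cast (hHl l).trans_le (hHN l)
  let r : ℕ → ℝ := fun l => ((N l : ℝ)⁻¹) ^ σ
  have hr0 : ∀ l, 0 < r l := fun l => Real.rpow_pos_of_pos (inv_pos.2 (hN0 l)) _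
  have hr : Filter.Tendsto r Filter.atTop (nhds 0) := by
    have h1 : Filter.Tendsto (fun l => (N l : ℝ)) Filter.atTop Filter.atTop :=
      Filter.tendsto_atTop_mono (fun l => (hHl l).le.trans (hHN l)) tendsto_natCast_atTop_atTop
    simpa [Real.zero_rpow hσ.ne'] using
      (tendsto_inv_atTop_zero.comp h1).rpow_const (Or.inr hσ.le)
  let s : ℕ → Set (Fin n → ℝ) := fun l => {y | ∃ (a : Fin m → ℤ) (b : Fin n → ℤ),
    (∀ i, y i = (∑ j, (a j : ℝ) * α j i) - b i) ∧ ∀ j, |(a j : ℝ)| ≤ (N l : ℝ) ^ η j}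
  let M : ℝ := (k + 1) * (c * (C + 1)) ^ σ
  have hM : 0 < M := by positivity
  have hs : ∀ l, ∀ x : Fin n → ℝ, ∃ y ∈ s l, ∀ i, |y i - x i| ^ (σ / τ i) ≤ M * r l := by
    intro l x
    obtain ⟨a, b, hab, ha⟩ := exists_inhomogeneous_approx hτ hη hw α hc (hHc l) k hk (hH l) x
    refine ⟨_, ⟨a, b, fun i => rfl, fun j => (ha j).le.trans ?_⟩, fun i => ?_⟩
    · calc (k + 1 : ℝ) * H l ^ η j ≤ C ^ η j * H l ^ η j := by
            gcongr
            · exact (Real.rpow_pos_of_pos (hH0 l) _).le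
            · exact hCη j
        _ = (C * H l) ^ η j := (Real.mul_rpow hC0.le (hH0 l).le).symm
        _ ≤ (N l : ℝ) ^ η j :=
            Real.rpow_le_rpow (mul_pos hC0 (hH0 l)).le (hN1 l) (hη j).le
    · have hcH : 0 ≤ c * (H l)⁻¹ := mul_nonneg hc.le (inv_nonneg.2 (hH0 l).le)
      have hinv : (H l)⁻¹ ≤ (C + 1) * (N l : ℝ)⁻¹ := by
        rw [inv_le_iff_one_le_mul₀ (hH0 l), mul_right_comm, ← div_eq_mul_inv,
          one_le_div (hN0 l)]
        exact hN2 l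
      calc |(∑ j, (a j : ℝ) * α j i) - b i - x i| ^ (σ / τ i)
          ≤ ((k + 1) * (c * (H l)⁻¹) ^ τ i) ^ (σ / τ i) :=
            Real.rpow_le_rpow (abs_nonneg _) (hab i).le (hp0 i).le
        _ = (k + 1) ^ (σ / τ i) * (c * (H l)⁻¹) ^ σ := by
            rw [Real.mul_rpow hk0.le (Real.rpow_nonneg hcH _), ← Real.rpow_mul hcH, hτσ]
        _ ≤ (k + 1) * (c * ((C + 1) * (N l : ℝ)⁻¹)) ^ σ := by
            refine mul_le_mul (Real.rpow_le_self_of_one_le hk1 (hp1 i))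
              (Real.rpow_le_rpow hcH ?_ hσ.le) (Real.rpow_nonneg hcH _) hk0.le
            exact mul_le_mul_of_nonneg_left hinv hc.le
        _ = M * r l := by
            rw [← mul_assoc c, Real.mul_rpow (by positivity) (inv_nonneg.2 (hN0 l).le),
              ← mul_assoc]
  have hae : ∀ᵐ x : Fin n → ℝ, ∀ q : ℕ, ∃ᶠ l in Filter.atTop, ∃ y ∈ s l,
      ∀ i, |y i - x i| ^ (σ / τ i) < (1 / (q + 1 : ℝ)) ^ σ * r l :=
    ae_all_iff.2 fun q => ae_frequently_exists_rpow_lt hp0 hp1 hr0 hr hM hs (by positivity)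
  filter_upwards [hae] with γ hγ ε hε
  obtain ⟨q, hq⟩ := exists_nat_one_div_lt hε
  refine Set.infinite_of_forall_exists_gt fun l₀ => ?_
  obtain ⟨l, ⟨y, ⟨a, b, hy, ha⟩, hyγ⟩, hl⟩ :=
    ((hγ q).and_eventually (Filter.eventually_ge_atTop l₀)).exists
  have hεN : 0 < ε * (N l : ℝ)⁻¹ := mul_pos hε (inv_pos.2 (hN0 l))
  refine ⟨N l, ⟨a, b, (quasiNorm_lt_iff hτ _ hεN).2 fun i => ?_,
    (quasiNorm_le_iff hη _ (hN0 l).le).2 ha⟩, hl.trans_lt (hNl l)⟩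
  rw [← hy i, ← Real.rpow_lt_rpow_iff (abs_nonneg _) (Real.rpow_nonneg hεN.le _) (hp0 i),
    ← Real.rpow_mul hεN.le, hτσ, Real.mul_rpow hε.le (inv_nonneg.2 (hN0 l).le)]
  exact (hyγ i).trans_le (mul_le_mul_of_nonneg_right
    (Real.rpow_le_rpow (by positivity) hq.le hσ.le) (hr0 l).le)
end

section
/- Let α be a real m×n matrix that is (τ,η)-non-singular, and let C > 0 and the unbounded increasing sequence (H_i) be such that for every i and every γ ∈ ℝ^n there exists (a, b) ∈ ℤ^m × ℤ^n with |aα − b − γ|_τ < C H_i^{-1} and |a|_η ≤ H_i. Then for Lebesgue-almost every γ ∈ ℝ^n, the set of pairs (a, b) ∈ ℤ^m × ℤ^n for which |aα − b − γ|_τ < C H_i^{-1} and |a|_η ≤ H_i holds for some i is infinite. -/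
theorem rpow_abs_le_quasiNorm {n : ℕ} (τ : Fin n → ℝ) (x : Fin n → ℝ) (i : Fin n) :
    |x i| ^ (1 / τ i) ≤ quasiNorm τ x :=
  le_ciSup (f := fun i => |x i| ^ (1 / τ i)) (Set.finite_range _).bddAbove i

theorem eq_zero_of_quasiNorm_nonpos {n : ℕ} {τ x : Fin n → ℝ}
    (hx : quasiNorm τ x ≤ 0) : x = 0 := by
  funext i
  by_contra hi
  exact (Real.rpow_pos_of_pos (abs_pos.mpr hi) (1 / τ i)).not_ge
    ((rpow_abs_le_quasiNorm τ x i).trans hx)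

/-- For a.e. `γ`, infinitely many `(a,b)` arise as solutions of the twisted
asymptotic Dirichlet inequalities. -/
theorem twisted_dirichlet_infinitely_many_solutions (m n : ℕ) (hm : 0 < m) (hn : 0 < n)
    (τ : Fin n → ℝ) (η : Fin m → ℝ)
    (hτ : ∀ i, 0 < τ i) (hη : ∀ j, 0 < η j)
    (hw : ∑ i, τ i = ∑ j, η j)
    (α : Matrix (Fin m) (Fin n) ℝ) (hα : ¬ IsSingular τ η α)
    (C : ℝ) (hC : 0 < C) (H : ℕ → ℝ) (hHpos : ∀ i, 0 < H i)
    (hHmono : StrictMono H) (hHunbdd : ∀ M : ℝ, ∃ i, M < H i)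
    (hdir : ∀ (i : ℕ) (γ : Fin n → ℝ), ∃ (a : Fin m → ℤ) (b : Fin n → ℤ),
      quasiNorm τ (fun k => (∑ j, (a j : ℝ) * α j k) - (b k : ℝ) - γ k) < C * (H i)⁻¹ ∧
      quasiNorm η (fun j => (a j : ℝ)) ≤ H i) :
    ∀ᵐ γ ∂(MeasureTheory.volume : MeasureTheory.Measure (Fin n → ℝ)),
      {p : (Fin m → ℤ) × (Fin n → ℤ) | ∃ i : ℕ,
        quasiNorm τ (fun k => (∑ j, (p.1 j : ℝ) * α j k) - (p.2 k : ℝ) - γ k) < C * (H i)⁻¹ ∧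
        quasiNorm η (fun j => (p.1 j : ℝ)) ≤ H i}.Infinite := by
  have : Nonempty (Fin n) := ⟨⟨0, hn⟩⟩
  have hHtop : Filter.Tendsto H Filter.atTop Filter.atTop :=
    Filter.tendsto_atTop_atTop_of_monotone hHmono.monotone fun M =>
      (hHunbdd M).imp fun _ h => h.le
  have hlim : Filter.Tendsto (fun i => C * (H i)⁻¹) Filter.atTop (nhds 0) := by
    simpa using hHtop.inv_tendsto_atTop.const_mul C
  have hcount : (Set.range fun p : (Fin m → ℤ) × (Fin n → ℤ) =>
      fun k => (∑ j, (p.1 j : ℝ) * α j k) - (p.2 k : ℝ)).Countable :=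
    Set.countable_range _
  filter_upwards [hcount.ae_notMem MeasureTheory.volume] with γ hγ hfin
  choose a b hab using fun i => hdir i γ
  have := hfin.to_subtype
  obtain ⟨⟨p, _⟩, hp⟩ := Finite.exists_infinite_fiber
    (fun i => (⟨(a i, b i), i, hab i⟩ : ↥{p : (Fin m → ℤ) × (Fin n → ℤ) | ∃ i : ℕ,
      quasiNorm τ (fun k => (∑ j, (p.1 j : ℝ) * α j k) - (p.2 k : ℝ) - γ k) < C * (H i)⁻¹ ∧
      quasiNorm η (fun j => (p.1 j : ℝ)) ≤ H i}))
  refine hγ ⟨p, ?_⟩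
  have hzero : (fun k => (∑ j, (p.1 j : ℝ) * α j k) - (p.2 k : ℝ) - γ k) = 0 := by
    refine eq_zero_of_quasiNorm_nonpos (τ := τ) (ge_of_tendsto_of_frequently hlim ?_)
    refine (Nat.frequently_atTop_iff_infinite.mpr (Set.infinite_coe_iff.mp hp)).mono fun i hi => ?_
    obtain rfl : (a i, b i) = p := congrArg Subtype.val hi
    exact (hab i).1.le
  funext k
  exact sub_eq_zero.mp (congrFun hzero k)
end

section
/- S-arithmetic weighted Dirichlet theorem (case ∞ ∉ S): Suppose every place in S is finite. Then for any x = (x_{i,j,ν}) ∈ ℤ_S^{mn} and any H > 1 there exists (a, b) = (a_1, …, a_m, b_1, …, b_n) ∈ ℤ^{m+n} ∖ {0} satisfying: |a_1 x_{i,1,ν} + ⋯ + a_m x_{i,m,ν} − b_i|_ν ≤ ν · H^{−τ_{i,ν}} for all 1 ≤ i ≤ n and all ν ∈ S; |a_j| ≤ H^{η_j} for 1 ≤ j ≤ m; and |b_i| ≤ H^{η_{m+i}} for 1 ≤ i ≤ n. -/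
instance (q : Nat.Primes) : Fact (Nat.Prime (q : ℕ)) := ⟨q.2⟩

/-- Between consecutive powers of `p`, some `p ^ k` satisfies `t / p < p ^ k ≤ t`. -/
lemma exists_pow_le_and_inv_pow_le {p : ℕ} (hp : 1 < p) {t : ℝ} (ht : 1 ≤ t) :
    ∃ k : ℕ, (p : ℝ) ^ k ≤ t ∧ (p : ℝ) ^ (-(k : ℤ)) ≤ p * t⁻¹ := by
  obtain ⟨k, hk, hk'⟩ := exists_nat_pow_near ht (show (1 : ℝ) < p by exact_mod_cast hp)
  refine ⟨k, hk, ?_⟩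
  have hp0 : (0 : ℝ) < p := by positivity
  have ht0 : (0 : ℝ) < t := by linarith
  rw [zpow_neg, zpow_natCast, ← div_eq_mul_inv, inv_eq_one_div,
    div_le_div_iff₀ (by positivity) ht0, one_mul, ← pow_succ']
  exact hk'.le

/-- Two `p`-adic integers with the same residue modulo `p ^ k` differ by at most `p ^ (-k)`. -/
lemma PadicInt.norm_sub_le_of_toZModPow_eq {p : ℕ} [Fact p.Prime] {k : ℕ} {y z : ℤ_[p]}
    (h : PadicInt.toZModPow k y = PadicInt.toZModPow k z) :
    ‖y - z‖ ≤ (p : ℝ) ^ (-(k : ℤ)) := by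
  rw [PadicInt.norm_le_pow_iff_mem_span_pow, ← PadicInt.ker_toZModPow, RingHom.mem_ker, map_sub,
    h, sub_self]

/-- The box of integer points `0 ≤ c ℓ ≤ B ℓ` has more than `∏ ℓ, B ℓ` elements. -/
lemma prod_lt_card_piFinset_Icc_floor {ι : Type*} [Fintype ι] [DecidableEq ι] [Nonempty ι]
    {B : ι → ℝ} (hB : ∀ l, 0 < B l) :
    ∏ l, B l < ((Fintype.piFinset fun l => Finset.Icc (0 : ℤ) ⌊B l⌋).card : ℝ) := by
  rw [Fintype.card_piFinset, Nat.cast_prod]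
  refine Finset.prod_lt_prod_of_nonempty (fun l _ => hB l) (fun l _ => ?_) Finset.univ_nonempty
  have h0 : 0 ≤ ⌊B l⌋ := Int.floor_nonneg.2 (hB l).le
  have h1 : (((Finset.Icc (0 : ℤ) ⌊B l⌋).card : ℤ) : ℝ) = ⌊B l⌋ + 1 := by
    rw [Int.card_Icc, Int.toNat_of_nonneg (by lia)]
    push_cast
    ring
  rw [Int.cast_natCast] at h1
  rw [h1]
  exact Int.lt_floor_add_one _

/-- Two integer points of `[0, B]` differ by at most `B`. -/
lemma abs_intCast_sub_le_of_mem_Icc_floor {B : ℝ} {c d : ℤ} (hc : c ∈ Finset.Icc 0 ⌊B⌋)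
    (hd : d ∈ Finset.Icc 0 ⌊B⌋) : |((c - d : ℤ) : ℝ)| ≤ B := by
  rw [Finset.mem_Icc] at hc hd
  rw [← Int.cast_abs]
  exact Int.le_floor.1 (abs_le.2 ⟨by lia, by lia⟩)

/-- S-arithmetic weighted Dirichlet theorem in the case `∞ ∉ S`.
`S` is a finite nonempty set of primes, `τ = (τ_{i,ν})` and `η = (η_ℓ)_{ℓ ≤ m+n}`
are weights with `Σ τ_{i,ν} = m + n = Σ η_ℓ`. -/
theorem s_arithmetic_weighted_dirichlet_no_infty
    (m n : ℕ) (hm : 0 < m) (hn : 0 < n)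
    (S : Finset Nat.Primes) (hS : S.Nonempty)
    (τ : Fin n → {ν // ν ∈ S} → ℝ) (η : Fin (m + n) → ℝ)
    (hτ : ∀ i ν, 0 < τ i ν) (hη : ∀ ℓ, 0 < η ℓ)
    (hτsum : ∑ i, ∑ ν : {ν // ν ∈ S}, τ i ν = (m + n : ℝ))
    (hηsum : ∑ ℓ, η ℓ = (m + n : ℝ))
    (x : ∀ ν : {ν // ν ∈ S}, Fin n → Fin m → ℚ_[(ν : Nat.Primes)])
    (hx : ∀ ν i j, ‖x ν i j‖ ≤ 1)
    (H : ℝ) (hH : 1 < H) :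
    ∃ (a : Fin m → ℤ) (b : Fin n → ℤ), ¬(a = 0 ∧ b = 0) ∧
      (∀ (ν : {ν // ν ∈ S}) (i : Fin n),
        ‖(∑ j, (a j : ℚ_[(ν : Nat.Primes)]) * x ν i j) - (b i : ℚ_[(ν : Nat.Primes)])‖
          ≤ ((ν : Nat.Primes) : ℕ) * H ^ (-(τ i ν))) ∧
      (∀ j : Fin m, |(a j : ℝ)| ≤ H ^ η (Fin.castAdd n j)) ∧
      (∀ i : Fin n, |(b i : ℝ)| ≤ H ^ η (Fin.natAdd m i)) := by
  have hH0 : 0 < H := by linarith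
  have : Nonempty (Fin (m + n)) := ⟨⟨0, by lia⟩⟩
  have hk (i : Fin n) (ν : {ν // ν ∈ S}) := exists_pow_le_and_inv_pow_le (ν : Nat.Primes).2.one_lt
    (Real.one_le_rpow hH.le (hτ i ν).le)
  choose k hk_le hk_inv using hk
  have hne (i : Fin n) (ν : {ν // ν ∈ S}) : NeZero (((ν : Nat.Primes) : ℕ) ^ k i ν) :=
    ⟨pow_ne_zero _ (ν : Nat.Primes).2.ne_zero⟩
  let X (ν : {ν // ν ∈ S}) (i : Fin n) (j : Fin m) : ℤ_[(ν : Nat.Primes)] := ⟨x ν i j, hx ν i j⟩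
  let L (c : Fin (m + n) → ℤ) (i : Fin n) (ν : {ν // ν ∈ S}) : ℤ_[(ν : Nat.Primes)] :=
    (∑ j, (c (Fin.castAdd n j) : ℤ_[(ν : Nat.Primes)]) * X ν i j) - c (Fin.natAdd m i)
  let F (c : Fin (m + n) → ℤ) (i : Fin n) (ν : {ν // ν ∈ S}) :
      ZMod (((ν : Nat.Primes) : ℕ) ^ k i ν) := PadicInt.toZModPow (k i ν) (L c i ν)
  let D := Fintype.piFinset fun l : Fin (m + n) => Finset.Icc (0 : ℤ) ⌊H ^ η l⌋
  have hcard : (Finset.univ : Finset (∀ (i : Fin n) (ν : {ν // ν ∈ S}),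
      ZMod (((ν : Nat.Primes) : ℕ) ^ k i ν))).card < D.card := by
    rw [← Nat.cast_lt (α := ℝ)]
    refine lt_of_le_of_lt ?_ (prod_lt_card_piFinset_Icc_floor fun l => Real.rpow_pos_of_pos hH0 _)
    rw [← Real.rpow_sum_of_pos hH0, hηsum, ← hτsum, Real.rpow_sum_of_pos hH0, Finset.card_univ,
      Fintype.card_pi, Nat.cast_prod]
    refine Finset.prod_le_prod (fun _ _ => by positivity) fun i _ => ?_
    rw [Real.rpow_sum_of_pos hH0, Fintype.card_pi, Nat.cast_prod]
    refine Finset.prod_le_prod (fun _ _ => by positivity) fun ν _ => ?_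
    rw [ZMod.card, Nat.cast_pow]
    exact hk_le i ν
  obtain ⟨c, hc, d, hd, hcd, hF⟩ := Finset.exists_ne_map_eq_of_card_lt_of_maps_to hcard
    (f := F) fun _ _ => Finset.mem_coe.2 (Finset.mem_univ _)
  rw [Fintype.mem_piFinset] at hc hd
  refine ⟨fun j => c (Fin.castAdd n j) - d (Fin.castAdd n j),
    fun i => c (Fin.natAdd m i) - d (Fin.natAdd m i), ?_, fun ν i => ?_,
    fun j => abs_intCast_sub_le_of_mem_Icc_floor (hc _) (hd _),
    fun i => abs_intCast_sub_le_of_mem_Icc_floor (hc _) (hd _)⟩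
  · rintro ⟨ha, hb⟩
    refine hcd (funext fun l => sub_eq_zero.1 ?_)
    induction l using Fin.addCases with
    | left j => exact congrFun ha j
    | right i => exact congrFun hb i
  · rw [Real.rpow_neg hH0.le]
    refine le_trans (le_of_eq ?_) ((PadicInt.norm_sub_le_of_toZModPow_eq
      (congrFun (congrFun hF i) ν)).trans (hk_inv i ν))
    have hX (j : Fin m) : (X ν i j : ℚ_[(ν : Nat.Primes)]) = x ν i j := rfl
    rw [PadicInt.norm_def]
    congr 1
    simp only [L, hX, PadicInt.coe_sub, PadicInt.coe_sum, PadicInt.coe_mul, PadicInt.coe_intCast,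
      Int.cast_sub, sub_mul, Finset.sum_sub_distrib]
    ring
end

section
/- S-arithmetic weighted Dirichlet theorem (case ∞ ∈ S): Suppose ∞ ∈ S, and write S* := S ∖ {∞}. Then for any x = (x_{i,j,ν}) ∈ ℤ_S^{mn} and any H > 1 there exists (a, b) = (a_1, …, a_m, b_1, …, b_n) ∈ ℤ^{m+n} ∖ {0} satisfying: |a_1 x_{i,1,ν} + ⋯ + a_m x_{i,m,ν} − b_i|_ν ≤ ν · H^{−τ_{i,ν}} for all 1 ≤ i ≤ n and all ν ∈ S*; |a_1 x_{i,1,∞} + ⋯ + a_m x_{i,m,∞} − b_i| < H^{−τ_{i,∞}} for all 1 ≤ i ≤ n; and |a_j| ≤ H^{η_j} for all 1 ≤ j ≤ m. -/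
/-- **Minkowski's theorem on linear forms**, for the unipotent system of forms
`a ↦ a j` and `(a, d) ↦ ∑ j, z i j * a j + d i`. -/
theorem exists_int_abs_lt_of_one_lt_prod {m n : Type*} [Fintype m] [Fintype n]
    (z : Matrix n m ℝ) (B : m → ℝ) (δ : n → ℝ) (hB : ∀ j, 0 < B j) (hδ : ∀ i, 0 < δ i)
    (h : 1 < (∏ j, B j) * ∏ i, δ i) :
    ∃ (a : m → ℤ) (d : n → ℤ), ¬(a = 0 ∧ d = 0) ∧ (∀ j, |(a j : ℝ)| < B j) ∧
      ∀ i, |∑ j, z i j * a j + d i| < δ i := by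
  classical
  set r : m ⊕ n → ℝ := Sum.elim B δ with hr
  have hr0 : ∀ k, 0 < r k := by rintro (j | i) <;> simp [hr, hB, hδ]
  set f : (m ⊕ n → ℝ) →ₗ[ℝ] (m ⊕ n → ℝ) :=
    Matrix.toLin' (Matrix.fromBlocks 1 0 z 1) with hf
  have hdet : LinearMap.det f = 1 := by
    rw [hf, LinearMap.det_toLin', Matrix.det_fromBlocks_zero₁₂]; simp
  set box : Set (m ⊕ n → ℝ) := Set.univ.pi fun k => Set.Ioo (-r k) (r k) with hbox
  let b := Pi.basisFun ℝ (m ⊕ n)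
  have hvol : MeasureTheory.volume (f ⁻¹' box) =
      ENNReal.ofReal (2 ^ Fintype.card (m ⊕ n) * ((∏ j, B j) * ∏ i, δ i)) := by
    rw [MeasureTheory.Measure.addHaar_preimage_linearMap _ (by simp [hdet]), hdet, hbox,
      Real.volume_pi_Ioo, ← ENNReal.ofReal_prod_of_nonneg]
    · have : ∏ k, (r k - -r k) = ∏ k, 2 * r k := by congr! 1; ring
      rw [this, Finset.prod_mul_distrib, Fintype.prod_sum_type r]
      simp [hr]
    · intro k _; linarith [hr0 k]
  have hfund : MeasureTheory.volume (ZSpan.fundamentalDomain b) = 1 := by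
    simp [b, ZSpan.fundamentalDomain_pi_basisFun, Real.volume_pi_Ico]
  have hconv : Convex ℝ (f ⁻¹' box) :=
    (convex_pi fun k _ => convex_Ioo (-r k) (r k)).linear_preimage f
  have hsymm : ∀ x ∈ f ⁻¹' box, -x ∈ f ⁻¹' box := by
    intro x hx
    simp only [hbox, Set.mem_preimage, Set.mem_univ_pi, Set.mem_Ioo, map_neg, Pi.neg_apply] at hx ⊢
    exact fun k => ⟨by linarith [(hx k).2], by linarith [(hx k).1]⟩
  have : Countable (Submodule.span ℤ (Set.range b)).toAddSubgroup :=
    inferInstanceAs (Countable (Submodule.span ℤ (Set.range b)))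
  obtain ⟨⟨x, hxL⟩, hx0, hx⟩ :=
    MeasureTheory.exists_ne_zero_mem_lattice_of_measure_mul_two_pow_lt_measure
      (L := (Submodule.span ℤ (Set.range b)).toAddSubgroup)
      (ZSpan.isAddFundamentalDomain b MeasureTheory.volume) (s := f ⁻¹' box)
      hsymm hconv (by
        rw [hfund, hvol, one_mul, Module.finrank_fintype_fun_eq_card]
        have : (2 : ENNReal) ^ Fintype.card (m ⊕ n) =
            ENNReal.ofReal (2 ^ Fintype.card (m ⊕ n)) := by
          rw [ENNReal.ofReal_pow (by norm_num)]; simp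
        rw [this, ENNReal.ofReal_lt_ofReal_iff (by positivity)]
        exact lt_mul_of_one_lt_right (by positivity) h)
  have hint : ∀ k, ∃ c : ℤ, (c : ℝ) = x k := by
    have := (b.mem_span_iff_repr_mem ℤ x).1 hxL
    simpa [b] using this
  choose c hc using hint
  simp only [hbox, Set.mem_preimage, Set.mem_univ_pi, Set.mem_Ioo, ← abs_lt] at hx
  refine ⟨fun j => c (.inl j), fun i => c (.inr i), ?_, fun j => ?_, fun i => ?_⟩
  · rintro ⟨h1, h2⟩
    apply hx0
    ext k
    rcases k with j | i
    · simpa [← hc] using congrFun h1 j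
    · simpa [← hc] using congrFun h2 i
  · simpa [hf, hr, hc, Matrix.fromBlocks_mulVec] using hx (.inl j)
  · simpa [hf, hr, hc, Matrix.fromBlocks_mulVec, Matrix.mulVec, dotProduct, Matrix.one_apply]
      using hx (.inr i)

/-- Simultaneous approximation of `p`-adic integers, for finitely many primes `p`, by an integer. -/
theorem exists_int_forall_pow_dvd_padicInt_sub (S : Finset Nat.Primes)
    (k : {ν // ν ∈ S} → ℕ) (X : ∀ ν : {ν // ν ∈ S}, ℤ_[(ν : Nat.Primes)]) :
    ∃ c : ℤ, ∀ ν : {ν // ν ∈ S},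
      (((ν : Nat.Primes) : ℕ) : ℤ_[(ν : Nat.Primes)]) ^ k ν ∣ X ν - c := by
  obtain ⟨c, hc⟩ := Nat.chineseRemainderOfFinset (fun ν => (X ν).appr (k ν))
    (fun ν : {ν // ν ∈ S} => ((ν : Nat.Primes) : ℕ) ^ k ν) Finset.univ
    (fun ν _ => pow_ne_zero _ ν.1.2.ne_zero)
    (fun ν _ μ _ hne => Nat.Coprime.pow _ _ <| (Nat.coprime_primes ν.1.2 μ.1.2).2
      fun h => hne (Subtype.ext (Subtype.ext h)))
  refine ⟨c, fun ν => ?_⟩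
  have h1 := Ideal.mem_span_singleton.1 (PadicInt.appr_spec (k ν) (X ν))
  have h2 := map_dvd (Int.castRingHom ℤ_[(ν : Nat.Primes)])
    (Nat.modEq_iff_dvd.1 (hc ν (Finset.mem_univ _)))
  simp only [map_sub, Int.coe_castRingHom, Int.cast_natCast, Nat.cast_pow, Int.cast_pow] at h2
  simpa using dvd_add h1 h2

/-- S-arithmetic weighted Dirichlet theorem in the case `∞ ∈ S`.
`S = Sfin ∪ {∞}` where `Sfin` is a (possibly empty) finite set of primes; here
`ω = m`, the weights at the finite places are `τfin` and at `∞` are `τinf`,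
and `Σ_{i,ν} τ_{i,ν} = m = Σ_{ℓ ≤ m} η_ℓ`. -/
theorem s_arithmetic_weighted_dirichlet_with_infty
    (m n : ℕ) (hm : 0 < m) (hn : 0 < n)
    (Sfin : Finset Nat.Primes)
    (τfin : Fin n → {ν // ν ∈ Sfin} → ℝ) (τinf : Fin n → ℝ) (η : Fin m → ℝ)
    (hτfin : ∀ i ν, 0 < τfin i ν) (hτinf : ∀ i, 0 < τinf i) (hη : ∀ ℓ, 0 < η ℓ)
    (hτsum : ∑ i, (τinf i + ∑ ν : {ν // ν ∈ Sfin}, τfin i ν) = (m : ℝ))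
    (hηsum : ∑ ℓ, η ℓ = (m : ℝ))
    (xfin : ∀ ν : {ν // ν ∈ Sfin}, Fin n → Fin m → ℚ_[(ν : Nat.Primes)])
    (hxfin : ∀ ν i j, ‖xfin ν i j‖ ≤ 1)
    (xinf : Fin n → Fin m → ℝ)
    (hxinf : ∀ i j, xinf i j ∈ Set.Ico (0 : ℝ) 1)
    (H : ℝ) (hH : 1 < H) :
    ∃ (a : Fin m → ℤ) (b : Fin n → ℤ), ¬(a = 0 ∧ b = 0) ∧
      (∀ (ν : {ν // ν ∈ Sfin}) (i : Fin n),
        ‖(∑ j, (a j : ℚ_[(ν : Nat.Primes)]) * xfin ν i j) - (b i : ℚ_[(ν : Nat.Primes)])‖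
          ≤ ((ν : Nat.Primes) : ℕ) * H ^ (-(τfin i ν))) ∧
      (∀ i : Fin n,
        |(∑ j, (a j : ℝ) * xinf i j) - (b i : ℝ)| < H ^ (-(τinf i))) ∧
      (∀ j : Fin m, |(a j : ℝ)| ≤ H ^ η j) := by
  have hH0 : 0 < H := one_pos.trans hH
  have hk : ∀ i (ν : {ν // ν ∈ Sfin}), ∃ k : ℕ,
      (((ν : Nat.Primes) : ℕ) : ℝ) ^ k ≤ H ^ τfin i ν ∧
        H ^ τfin i ν < (((ν : Nat.Primes) : ℕ) : ℝ) ^ (k + 1) := fun i ν =>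
    exists_nat_pow_near (Real.one_le_rpow hH.le (hτfin i ν).le)
      (by exact_mod_cast ν.1.2.one_lt)
  choose k hkle hklt using hk
  let X : ∀ ν : {ν // ν ∈ Sfin}, Fin n → Fin m → ℤ_[(ν : Nat.Primes)] :=
    fun ν i j => ⟨xfin ν i j, hxfin ν i j⟩
  choose c hc using fun i j =>
    exists_int_forall_pow_dvd_padicInt_sub Sfin (k i) (fun ν => X ν i j)
  let N : Fin n → ℕ := fun i => ∏ ν : {ν // ν ∈ Sfin}, ((ν : Nat.Primes) : ℕ) ^ k i ν
  have hN : ∀ i, 0 < N i := fun i => Finset.prod_pos fun ν _ => pow_pos ν.1.2.pos _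
  have hNR : ∀ i, (0 : ℝ) < N i := fun i => Nat.cast_pos.2 (hN i)
  have hNle : ∀ i, (N i : ℝ) ≤ H ^ ∑ ν, τfin i ν := by
    intro i
    rw [Real.rpow_sum_of_pos hH0]
    simp only [N, Nat.cast_prod, Nat.cast_pow]
    exact Finset.prod_le_prod (fun _ _ => by positivity) fun ν _ => hkle i ν
  let B : Fin m → ℝ := fun j => ⌊H ^ η j⌋ + 1
  have hBlt : ∀ j, H ^ η j < B j := fun j => Int.lt_floor_add_one _
  have hprodB : H ^ (m : ℝ) < ∏ j, B j := by
    rw [← hηsum, Real.rpow_sum_of_pos hH0]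
    exact Finset.prod_lt_prod_of_nonempty (fun _ _ => by positivity) (fun j _ => hBlt j)
      ⟨⟨0, hm⟩, Finset.mem_univ _⟩
  let δ : Fin n → ℝ := fun i => H ^ (-τinf i) / N i
  have hδ : ∀ i, 0 < δ i := fun i => div_pos (by positivity) (hNR i)
  have hprodδ : H ^ (-(m : ℝ)) ≤ ∏ i, δ i := by
    rw [← hτsum, ← Finset.sum_neg_distrib, Real.rpow_sum_of_pos hH0]
    refine Finset.prod_le_prod (fun _ _ => by positivity) fun i _ => ?_
    rw [le_div_iff₀ (hNR i), neg_add, Real.rpow_add hH0, mul_assoc]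
    refine mul_le_of_le_one_right (by positivity) ?_
    rw [Real.rpow_neg hH0.le, inv_mul_le_one₀ (by positivity)]
    exact hNle i
  obtain ⟨a, d, hne, ha, hd⟩ := exists_int_abs_lt_of_one_lt_prod
    (Matrix.of fun i j => (xinf i j - c i j) / N i) B δ
    (fun j => (by positivity : 0 < H ^ η j).trans (hBlt j)) hδ (by
      calc (1 : ℝ) = H ^ (m : ℝ) * H ^ (-(m : ℝ)) := by
            rw [← Real.rpow_add hH0, add_neg_cancel, Real.rpow_zero]
        _ < (∏ j, B j) * H ^ (-(m : ℝ)) := by gcongr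
        _ ≤ _ := by
          gcongr)
  refine ⟨a, fun i => ∑ j, a j * c i j - N i * d i, ?_, fun ν i => ?_, fun i => ?_, fun j => ?_⟩
  · rintro ⟨rfl, hb⟩
    refine hne ⟨rfl, funext fun i => ?_⟩
    simpa [(hN i).ne'] using congrFun hb i
  · have hdvd : (((ν : Nat.Primes) : ℕ) : ℤ_[(ν : Nat.Primes)]) ^ k i ν ∣
        ∑ j, (a j : ℤ_[(ν : Nat.Primes)]) * (X ν i j - c i j) + N i * d i := by
      refine dvd_add (Finset.dvd_sum fun j _ => (hc i j ν).mul_left _) (Dvd.dvd.mul_right ?_ _)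
      simp only [N, Nat.cast_prod, Nat.cast_pow]
      exact_mod_cast Nat.cast_dvd_cast (Finset.dvd_prod_of_mem
        (fun ν : {ν // ν ∈ Sfin} => ((ν : Nat.Primes) : ℕ) ^ k i ν) (Finset.mem_univ ν))
    have hnorm := (PadicInt.norm_le_pow_iff_mem_span_pow _ _).2 (Ideal.mem_span_singleton.2 hdvd)
    have heq : (∑ j, (a j : ℚ_[(ν : Nat.Primes)]) * xfin ν i j) -
        ((∑ j, a j * c i j - N i * d i : ℤ) : ℚ_[(ν : Nat.Primes)]) =
        ((∑ j, (a j : ℤ_[(ν : Nat.Primes)]) * (X ν i j - c i j) + N i * d i :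
          ℤ_[(ν : Nat.Primes)]) : ℚ_[(ν : Nat.Primes)]) := by
      push_cast [PadicInt.coe_sum]
      simp only [X, mul_sub, Finset.sum_sub_distrib]
      ring
    rw [heq, ← PadicInt.norm_def]
    refine hnorm.trans ?_
    have hp : (0 : ℝ) < ((ν : Nat.Primes) : ℕ) := Nat.cast_pos.2 ν.1.2.pos
    rw [zpow_neg, zpow_natCast, Real.rpow_neg hH0.le, ← div_eq_mul_inv,
      inv_le_comm₀ (by positivity) (by positivity), inv_div, div_le_iff₀ hp, ← pow_succ]
    exact (hklt i ν).le
  · have h := hd i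
    rw [lt_div_iff₀ (hNR i), ← Nat.abs_cast, ← abs_mul] at h
    have heq : (∑ j, (a j : ℝ) * xinf i j) - ((∑ j, a j * c i j - N i * d i : ℤ) : ℝ) =
        (∑ j, (xinf i j - c i j) / N i * a j + d i) * N i := by
      have := (hNR i).ne'
      rw [add_mul, Finset.sum_mul]
      push_cast
      rw [← sub_add, ← Finset.sum_sub_distrib]
      congr 1
      · refine Finset.sum_congr rfl fun j _ => ?_
        field_simp
      · ring
    exact heq ▸ h
  · have h : |a j| < ⌊H ^ η j⌋ + 1 := by
      have := ha j
      simp only [B] at this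
      exact_mod_cast this
    exact_mod_cast Int.le_floor.1 (Int.lt_add_one_iff.1 h)
end

section
/- Suppose that either ∞ ∈ S, or η_{m+i} < Σ_{ν∈S} τ_{i,ν} for all 1 ≤ i ≤ n. Then there exists H_0 > 1 such that for all H > H_0 and all x ∈ ℤ_S^{mn}, every (a, b) ∈ ℤ^{m+n} ∖ {0} satisfying the S-arithmetic weighted Dirichlet inequalities — namely |a_1 x_{i,1,ν} + ⋯ + a_m x_{i,m,ν} − b_i|_ν ≤ ν H^{−τ_{i,ν}} for all i and finite ν ∈ S, |a_1 x_{i,1,∞} + ⋯ + a_m x_{i,m,∞} − b_i| < H^{−τ_{i,∞}} for all i if ∞ ∈ S, |a_j| ≤ H^{η_j} for 1 ≤ j ≤ m, and |b_i| ≤ H^{η_{m+i}} for 1 ≤ i ≤ n if ∞ ∉ S — must have a ≠ 0. -/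
/-- A lower bound from the product formula: a nonzero integer satisfies
`1 ≤ |b| * ∏ |b|_q`, the product ranging over any finite family of distinct primes. -/
theorem one_le_abs_mul_prod_padic_norm {b : ℤ} (hb : b ≠ 0) (S : Finset Nat.Primes) :
    1 ≤ |(b : ℝ)| * ∏ q : {q // q ∈ S}, ‖(b : ℚ_[(q : Nat.Primes)])‖ := by
  have hnorm : ∀ q : {q // q ∈ S}, ‖(b : ℚ_[(q : Nat.Primes)])‖
      = (((((q : Nat.Primes) : ℕ) ^ padicValInt ((q : Nat.Primes) : ℕ) b : ℕ) : ℝ))⁻¹ := by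
    intro q
    have h : (b : ℚ_[(q : Nat.Primes)]) ≠ 0 := by exact_mod_cast hb
    rw [Padic.norm_eq_zpow_neg_valuation h, Padic.valuation_intCast, zpow_neg, zpow_natCast]
    push_cast
    rfl
  have hdvd : (∏ q : {q // q ∈ S}, ((q : Nat.Primes) : ℕ) ^ padicValInt ((q : Nat.Primes) : ℕ) b)
      ∣ b.natAbs := by
    refine Fintype.prod_dvd_of_isRelPrime (fun q r hqr => ?_) fun q => pow_padicValNat_dvd
    refine Nat.coprime_iff_isRelPrime.mp (Nat.Coprime.pow _ _ ?_)
    exact (Nat.coprime_primes q.1.2 r.1.2).2 fun h => hqr (Subtype.ext (Subtype.ext h))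
  have hle := Nat.le_of_dvd (Int.natAbs_pos.2 hb) hdvd
  rw [Finset.prod_congr rfl fun q _ => hnorm q, Finset.prod_inv_distrib, ← Nat.cast_prod,
    ← div_eq_mul_inv, one_le_div]
  · rw [← Int.cast_abs, Int.abs_eq_natAbs]
    exact_mod_cast hle
  · exact Nat.cast_pos.2 (Finset.prod_pos fun q _ => pow_pos q.1.2.pos _)

/-- If `∞ ∈ S`, or `η_{m+i} < Σ_{ν∈S} τ_{i,ν}` for all `i`, then for all large `H`
any nonzero integer solution `(a,b)` of the S-arithmetic weighted Dirichlet
inequalities has `a ≠ 0`.  The boolean `inf` records whether `∞ ∈ S`; the set of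
finite places of `S` is `Sfin`. -/
theorem dirichlet_solutions_have_nonzero_a
    (m n : ℕ) (hm : 0 < m) (hn : 0 < n)
    (inf : Bool) (Sfin : Finset Nat.Primes)
    (hSne : inf = false → Sfin.Nonempty)
    (τfin : Fin n → {ν // ν ∈ Sfin} → ℝ) (τinf : Fin n → ℝ) (η : Fin (m + n) → ℝ)
    (hτfin : ∀ i ν, 0 < τfin i ν)
    (hτinf : inf = true → ∀ i, 0 < τinf i)
    (hηm : ∀ j : Fin m, 0 < η (Fin.castAdd n j))
    (hηn : inf = false → ∀ i : Fin n, 0 < η (Fin.natAdd m i))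
    (hτsum : if inf = true
      then ∑ i, (τinf i + ∑ ν : {ν // ν ∈ Sfin}, τfin i ν) = (m : ℝ)
      else ∑ i, ∑ ν : {ν // ν ∈ Sfin}, τfin i ν = (m + n : ℝ))
    (hηsum : if inf = true
      then ∑ j : Fin m, η (Fin.castAdd n j) = (m : ℝ)
      else ∑ ℓ, η ℓ = (m + n : ℝ))
    (hyp : inf = true ∨ ∀ i : Fin n, η (Fin.natAdd m i) < ∑ ν : {ν // ν ∈ Sfin}, τfin i ν) :
    ∃ H₀ : ℝ, 1 < H₀ ∧ ∀ H > H₀,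
      ∀ (xfin : ∀ ν : {ν // ν ∈ Sfin}, Fin n → Fin m → ℚ_[(ν : Nat.Primes)]),
        (∀ ν i j, ‖xfin ν i j‖ ≤ 1) →
      ∀ (xinf : Fin n → Fin m → ℝ), (inf = true → ∀ i j, xinf i j ∈ Set.Ico (0 : ℝ) 1) →
      ∀ (a : Fin m → ℤ) (b : Fin n → ℤ), ¬(a = 0 ∧ b = 0) →
        (∀ (ν : {ν // ν ∈ Sfin}) (i : Fin n),
          ‖(∑ j, (a j : ℚ_[(ν : Nat.Primes)]) * xfin ν i j) - (b i : ℚ_[(ν : Nat.Primes)])‖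
            ≤ ((ν : Nat.Primes) : ℕ) * H ^ (-(τfin i ν))) →
        (inf = true → ∀ i : Fin n,
          |(∑ j, (a j : ℝ) * xinf i j) - (b i : ℝ)| < H ^ (-(τinf i))) →
        (∀ j : Fin m, |(a j : ℝ)| ≤ H ^ η (Fin.castAdd n j)) →
        (inf = false → ∀ i : Fin n, |(b i : ℝ)| ≤ H ^ η (Fin.natAdd m i)) →
        a ≠ 0 := by
  rcases Bool.eq_false_or_eq_true inf with hinf | hinf
  · refine ⟨2, one_lt_two, fun H hH xfin _ xinf _ a b hab _ hreal _ _ ha => hab ⟨ha, ?_⟩⟩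
    funext i
    have h := hreal hinf i
    simp only [ha, Pi.zero_apply, Int.cast_zero, zero_mul, Finset.sum_const_zero, zero_sub,
      abs_neg] at h
    have h1 : H ^ (-(τinf i)) ≤ 1 :=
      Real.rpow_le_one_of_one_le_of_nonpos (by linarith) (by linarith [hτinf hinf i])
    have h2 : |b i| < 1 := by exact_mod_cast h.trans_le h1
    exact Int.abs_lt_one_iff.1 h2
  · have hδ : ∀ i : Fin n, 0 < ∑ ν : {ν // ν ∈ Sfin}, τfin i ν - η (Fin.natAdd m i) := by
      intro i
      rcases hyp with h | h
      · simp [hinf] at h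
      · linarith [h i]
    set δ : Fin n → ℝ := fun i => ∑ ν : {ν // ν ∈ Sfin}, τfin i ν - η (Fin.natAdd m i) with hδdef
    set P : ℝ := ∏ ν : {ν // ν ∈ Sfin}, (((ν : Nat.Primes) : ℕ) : ℝ) with hP
    have hP0 : 0 < P := Finset.prod_pos fun ν _ => by exact_mod_cast ν.1.2.pos
    have hterm : ∀ i, 0 ≤ P ^ (δ i)⁻¹ := fun i => Real.rpow_nonneg hP0.le _
    have hsum : 0 ≤ ∑ i, P ^ (δ i)⁻¹ := Finset.sum_nonneg fun i _ => hterm i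
    refine ⟨2 + ∑ i, P ^ (δ i)⁻¹, by linarith, ?_⟩
    intro H hH xfin _ xinf _ a b hab hfin _ _ hb ha
    have hH0 : 0 < H := by linarith
    refine hab ⟨ha, funext fun i => ?_⟩
    by_contra hbi
    have hPH : P < H ^ δ i := by
      rw [← Real.rpow_inv_lt_iff_of_pos hP0.le hH0.le (hδ i)]
      have := Finset.single_le_sum (fun i _ => hterm i) (Finset.mem_univ i)
      linarith
    have hprod : ∏ ν : {ν // ν ∈ Sfin}, ‖(b i : ℚ_[(ν : Nat.Primes)])‖
        ≤ P * H ^ (-∑ ν : {ν // ν ∈ Sfin}, τfin i ν) := by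
      rw [← Finset.sum_neg_distrib, Real.rpow_sum_of_pos hH0, hP, ← Finset.prod_mul_distrib]
      refine Finset.prod_le_prod (fun ν _ => norm_nonneg _) fun ν _ => ?_
      simpa [ha] using hfin ν i
    have hcontra : (1 : ℝ) < 1 := calc
      1 ≤ |(b i : ℝ)| * ∏ ν : {ν // ν ∈ Sfin}, ‖(b i : ℚ_[(ν : Nat.Primes)])‖ :=
        one_le_abs_mul_prod_padic_norm hbi Sfin
      _ ≤ H ^ η (Fin.natAdd m i) * (P * H ^ (-∑ ν : {ν // ν ∈ Sfin}, τfin i ν)) :=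
        mul_le_mul (hb hinf i) hprod (Finset.prod_nonneg fun ν _ => norm_nonneg _)
          (Real.rpow_nonneg hH0.le _)
      _ = P * H ^ (-δ i) := by
        rw [mul_left_comm, ← Real.rpow_add hH0, hδdef]
        congr 2
        ring
      _ < H ^ δ i * H ^ (-δ i) := mul_lt_mul_of_pos_right hPH (Real.rpow_pos_of_pos hH0 _)
      _ = 1 := by rw [← Real.rpow_add hH0, add_neg_cancel, Real.rpow_zero]
    exact lt_irrefl _ hcontra
end
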